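/- In the singular Minkowski plane (ℝ², N), let f : ℝ → ℝ satisfy f(t)/t → +∞ as t → +∞. Then for every (x₁,x₂) ∈ ℝ², lim_{t→+∞}[N(x₁ − f(t), x₂ + t) − N(f(t), −t)] = x₂ − x₁. In other words, the function φ₊(x₁,x₂) = x₂ − x₁ is a horofunction of (ℝ², N), arising as the limit of the normalized distance functions of the points (f(t), −t). -/

import Mathlib

open Filter

/-- The norm of the singular Minkowski plane. -/
noncomputable def singN (x : ℝ × ℝ) : ℝ :=
  Real.sqrt (x.1 ^ 2 + 2 * x.2 ^ 2) + |x.2|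

/-- The difference of two square roots, rescaled by a factor `c > 0`, with the numerator
rationalized. -/
theorem sqrt_sub_sqrt_eq_div_of_scaled {A B A' B' D c : ℝ} (hc : 0 < c) (hA' : 0 ≤ A')
    (hB' : 0 < B') (hA : A = c ^ 2 * A') (hB : B = c ^ 2 * B') (hD : A - B = c * D) :
    √A - √B = D / (√A' + √B') := by
  have hpos : 0 < √A' + √B' := add_pos_of_nonneg_of_pos (Real.sqrt_nonneg _) (Real.sqrt_pos.2 hB')
  rw [hA, hB, Real.sqrt_mul (sq_nonneg c), Real.sqrt_mul (sq_nonneg c), Real.sqrt_sq hc.le,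
    eq_div_iff hpos.ne']
  apply mul_left_cancel₀ hc.ne'
  rw [← hD, hA, hB]
  linear_combination c ^ 2 * Real.sq_sqrt hA' - c ^ 2 * Real.sq_sqrt hB'.le

/-- In the singular Minkowski plane, if `f t / t → +∞`, the normalized distance
functions of the points `(f t, -t)` converge pointwise to the horofunction
`φ₊(x₁,x₂) = x₂ - x₁`. -/
theorem horofunction_limit_of_superlinear (f : ℝ → ℝ)
    (hf : Tendsto (fun t => f t / t) atTop atTop) (x : ℝ × ℝ) :
    Tendsto (fun t : ℝ => singN (x.1 - f t, x.2 + t) - singN (f t, -t)) atTop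
      (nhds (x.2 - x.1)) := by
  obtain ⟨a, b⟩ := x
  have hu : Tendsto (fun t => t / f t) atTop (nhds 0) := by
    simpa [Pi.inv_def] using hf.inv_tendsto_atTop
  have hv : Tendsto (fun t => (f t)⁻¹) atTop (nhds 0) := by
    have h := hu.mul (tendsto_inv_atTop_zero (𝕜 := ℝ))
    rw [mul_zero] at h
    refine h.congr' ?_
    filter_upwards [eventually_gt_atTop 0] with t ht
    field_simp
  let g : ℝ × ℝ → ℝ := fun p =>
    (a ^ 2 * p.2 - 2 * a + 2 * b ^ 2 * p.2 + 4 * b * p.1) /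
      (√((a * p.2 - 1) ^ 2 + 2 * (b * p.2 + p.1) ^ 2) + √(1 + 2 * p.1 ^ 2)) + b
  have hg : ContinuousAt g (0, 0) := by
    refine ContinuousAt.add (ContinuousAt.div ?_ ?_ (by norm_num)) continuousAt_const <;>
      exact Continuous.continuousAt (by fun_prop)
  have hg0 : g (0, 0) = b - a := by
    norm_num [g]
    ring
  have hlim : Tendsto (fun t => g (t / f t, (f t)⁻¹)) atTop (nhds (b - a)) :=
    hg0 ▸ hg.tendsto.comp (hu.prodMk_nhds hv)
  refine hlim.congr' ?_
  filter_upwards [eventually_gt_atTop 0, eventually_gt_atTop (-b), hf.eventually_gt_atTop 0]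
    with t ht htb hft
  have hfpos : 0 < f t := (div_pos_iff_of_pos_right ht).1 hft
  have hsqrt := sqrt_sub_sqrt_eq_div_of_scaled
    (A := (a - f t) ^ 2 + 2 * (b + t) ^ 2) (B := f t ^ 2 + 2 * (-t) ^ 2)
    (A' := (a * (f t)⁻¹ - 1) ^ 2 + 2 * (b * (f t)⁻¹ + t / f t) ^ 2)
    (B' := 1 + 2 * (t / f t) ^ 2)
    (D := a ^ 2 * (f t)⁻¹ - 2 * a + 2 * b ^ 2 * (f t)⁻¹ + 4 * b * (t / f t))
    hfpos (by positivity) (by positivity) (by field_simp) (by field_simp)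
    (by field_simp; ring)
  simp only [singN, g, ← hsqrt, abs_neg, abs_of_pos ht, abs_of_pos (show 0 < b + t by linarith)]
  ring
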